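/- Let 𝔛 be a Banach space and 𝖠 ⊆ B(𝔛) compact and nonempty. Let X := 𝖠^ℤ with the product topology, let T : X → X be the shift homeomorphism T((A_i)_{i∈ℤ}) := (A_{i+1})_{i∈ℤ}, and define the continuous cocycle 𝒜(x, n) := A_n ⋯ A_1 for x = (A_i)_{i∈ℤ} ∈ X and n ∈ ℕ. Then log ρ_f(𝖠) = sup_{μ ∈ M_T} inf_{n≥1} (1/n) ∫ log ‖𝒜(x,n)‖_f dμ(x), where M_T denotes the set of T-invariant Borel probability measures on X and both sides take values in [−∞, ∞). -/

import Mathlib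

open Filter Topology MeasureTheory

noncomputable section

variable {𝕏 : Type*} [NormedAddCommGroup 𝕏] [NormedSpace ℝ 𝕏] [CompleteSpace 𝕏]

/-- The set `𝖠ⁿ` of all products of `n` elements of `A`. -/
def prods {R : Type*} [NormedRing R] (A : Set R) (n : ℕ) : Set R :=
  {P | ∃ f : Fin n → R, (∀ i, f i ∈ A) ∧ P = (List.ofFn f).prod}

/-- Logarithm with the convention `log 0 = -∞`. -/
def elog (x : ℝ) : EReal := if x = 0 then ⊥ else ((Real.log x : ℝ) : EReal)

/-- Truncation of an extended real to `ℝ≥0∞` (the positive part). -/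
def erealToENNReal (x : EReal) : ENNReal := if x = ⊤ then ⊤ else ENNReal.ofReal x.toReal

/-- Integral of an `EReal`-valued function: the difference of the integrals of the positive
and negative parts; for functions bounded above on a probability space it takes values in
`[-∞, ∞)`. -/
def integralEReal {X : Type*} [MeasurableSpace X] (μ : Measure X) (f : X → EReal) : EReal :=
  ((∫⁻ x, erealToENNReal (f x) ∂μ : ENNReal) : EReal)
    - ((∫⁻ x, erealToENNReal (-(f x)) ∂μ : ENNReal) : EReal)

/-- The shift homeomorphism on `X = 𝖠^ℤ`, `(T x)_i = x_{i+1}`. -/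
def shiftT (A : Set (𝕏 →L[ℝ] 𝕏)) : (ℤ → ↥A) → (ℤ → ↥A) := fun x i => x (i + 1)

/-- The continuous cocycle `𝒜(x, n) = A_n ⋯ A_1` over the shift on `𝖠^ℤ`,
where `x = (A_i)_{i ∈ ℤ}`. -/
def shiftCocycle (A : Set (𝕏 →L[ℝ] 𝕏)) (x : ℤ → ↥A) (n : ℕ) : 𝕏 →L[ℝ] 𝕏 :=
  (List.ofFn fun i : Fin n => ((x ((n : ℤ) - (i : ℕ))) : 𝕏 →L[ℝ] 𝕏)).prod

/-- `‖L‖_f`: the distance from `L` to the finite-rank operators. -/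
def fdist (L : 𝕏 →L[ℝ] 𝕏) : ℝ :=
  sInf {c : ℝ | ∃ K : 𝕏 →L[ℝ] 𝕏,
    FiniteDimensional ℝ (LinearMap.range (K : 𝕏 →ₗ[ℝ] 𝕏)) ∧ c = ‖L - K‖}

/-! ### Invariant limits of empirical measures -/

theorem exists_measurePreserving_tendsto_average {X : Type*} [TopologicalSpace X]
    [CompactSpace X] [T2Space X] [MeasurableSpace X] [BorelSpace X] [HasOuterApproxClosed X]
    {T : X → X} (hT : Continuous T) (x : ℕ → X) :
    ∃ (U : Ultrafilter ℕ) (μ : Measure X), (U : Filter ℕ) ≤ atTop ∧ IsProbabilityMeasure μ ∧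
      MeasurePreserving T μ μ ∧ ∀ g : X → ℝ, Continuous g →
        Tendsto (fun n : ℕ => ((n : ℝ) + 1)⁻¹ * ∑ k ∈ Finset.range (n + 1), g (T^[k] (x n)))
          U (𝓝 (∫ y, g y ∂μ)) := by
  let ν : ℕ → Measure X := fun n =>
    ((n : ENNReal) + 1)⁻¹ • ∑ k ∈ Finset.range (n + 1), Measure.dirac (T^[k] (x n))
  have hν : ∀ n, IsProbabilityMeasure (ν n) := fun n => ⟨by
    simp only [ν, Measure.smul_apply, Measure.finsetSum_apply, measure_univ, smul_eq_mul,
      Finset.sum_const, Finset.card_range, nsmul_eq_mul, mul_one, Nat.cast_add, Nat.cast_one]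
    exact ENNReal.inv_mul_cancel (by simp) (by simp)⟩
  have hint : ∀ n (g : X → ℝ), Continuous g → ∫ y, g y ∂(ν n) =
      ((n : ℝ) + 1)⁻¹ * ∑ k ∈ Finset.range (n + 1), g (T^[k] (x n)) := by
    intro n g hg
    rw [integral_smul_measure, integral_finsetSum_measure]
    · simp only [integral_dirac]
      rw [ENNReal.toReal_inv, ENNReal.toReal_add (by simp) (by simp)]
      simp
    · intro k _
      exact integrable_dirac (by simp)
  obtain ⟨U, hU⟩ := Ultrafilter.exists_le (atTop : Filter ℕ)
  let p : ℕ → ProbabilityMeasure X := fun n => ⟨ν n, hν n⟩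
  let m : ProbabilityMeasure X := (U.map p).lim
  have hp : Tendsto p U (𝓝 m) := (U.map p).le_nhds_lim
  rw [ProbabilityMeasure.tendsto_iff_forall_integral_tendsto] at hp
  have hlim : ∀ g : X → ℝ, Continuous g →
      Tendsto (fun n : ℕ => ((n : ℝ) + 1)⁻¹ * ∑ k ∈ Finset.range (n + 1), g (T^[k] (x n)))
          U (𝓝 (∫ y, g y ∂(m : Measure X))) := fun g hg =>
    (hp (BoundedContinuousFunction.mkOfCompact ⟨g, hg⟩)).congr fun n => hint n g hg
  refine ⟨U, m, hU, inferInstance, ⟨hT.measurable, ?_⟩, hlim⟩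
  have : IsProbabilityMeasure (Measure.map T (m : Measure X)) :=
    Measure.isProbabilityMeasure_map hT.aemeasurable
  refine ext_of_forall_integral_eq_of_IsFiniteMeasure fun g => ?_
  rw [integral_map hT.aemeasurable g.continuous.aestronglyMeasurable]
  have h1 := hlim _ (g.continuous.comp hT)
  have h2 := hlim _ g.continuous
  have hz : Tendsto (fun n : ℕ => ((n : ℝ) + 1)⁻¹ * (g (T^[n + 1] (x n)) - g (x n)))
      U (𝓝 0) := by
    have h0 : Tendsto (fun n : ℕ => ((n : ℝ) + 1)⁻¹) U (𝓝 0) := by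
      simpa using (tendsto_one_div_add_atTop_nhds_zero_nat (𝕜 := ℝ)).mono_left hU
    refine h0.zero_mul_isBoundedUnder_le ⟨2 * ‖g‖, ?_⟩
    simp only [eventually_map, Function.comp_apply]
    refine Eventually.of_forall fun n => ?_
    calc ‖g (T^[n + 1] (x n)) - g (x n)‖
        ≤ ‖g (T^[n + 1] (x n))‖ + ‖g (x n)‖ := norm_sub_le _ _
      _ ≤ 2 * ‖g‖ := by
        linarith [g.norm_coe_le_norm (T^[n + 1] (x n)), g.norm_coe_le_norm (x n)]
  refine tendsto_nhds_unique h1 ?_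
  have h3 := h2.add hz
  rw [add_zero] at h3
  refine h3.congr fun n => ?_
  rw [← mul_add]
  congr 1
  have e1 := Finset.sum_range_succ (fun k => g (T^[k] (x n))) (n + 1)
  rw [Finset.sum_range_succ'] at e1
  simp only [Function.comp_apply, ← Function.iterate_succ_apply', Function.iterate_zero,
    id_eq] at e1 ⊢
  linarith

/-! ### Submultiplicative sequences of functions -/

theorem sum_range_mul_eq_sum_sum (g : ℕ → ℝ) (q m : ℕ) :
    ∑ k ∈ Finset.range (q * m), g k =
      ∑ j ∈ Finset.range m, ∑ i ∈ Finset.range q, g (i * m + j) := by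
  rw [Finset.sum_comm]
  induction q with
  | zero => simp
  | succ q ih => rw [Nat.succ_mul, Finset.sum_range_add, ih, Finset.sum_range_succ]

theorem submultiplicative_le_prod {X : Type*} {T : X → X} {φ : ℕ → X → ℝ}
    (h0 : ∀ n x, 0 ≤ φ n x) (hsub : ∀ n m x, φ (n + m) x ≤ φ m (T^[n] x) * φ n x)
    (hone : ∀ x, φ 0 x ≤ 1) {m : ℕ} {H : X → ℝ} (hH : ∀ x, φ m x ≤ H x) (q : ℕ) (x : X) :
    φ (q * m) x ≤ ∏ i ∈ Finset.range q, H (T^[i * m] x) := by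
  induction q with
  | zero => simpa using hone x
  | succ q ih =>
    rw [Nat.succ_mul, Finset.prod_range_succ, mul_comm (Finset.prod _ _)]
    exact (hsub _ _ _).trans
      (mul_le_mul (hH _) ih (h0 _ _) ((h0 _ _).trans (hH _)))

theorem mul_log_le_sum_add {X : Type*} {T : X → X} {φ : ℕ → X → ℝ}
    (h0 : ∀ n x, 0 ≤ φ n x) (hsub : ∀ n m x, φ (n + m) x ≤ φ m (T^[n] x) * φ n x)
    {C : ℝ} (hC : 1 ≤ C) (hbd : ∀ n x, φ n x ≤ C ^ n) {ε : ℝ} (hε : 0 < ε) (hε1 : ε ≤ 1)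
    {m n : ℕ} (hm : 0 < m) (hn : 2 * m ≤ n) {x : X} (hx : 0 < φ n x) :
    m * Real.log (φ n x) ≤ ∑ k ∈ Finset.range n, Real.log (max (φ m (T^[k] x)) ε)
      + (m * (3 * m * Real.log C) + 2 * m * (-Real.log ε)) := by
  set H : X → ℝ := fun y => max (φ m y) ε with hHdef
  have hHpos : ∀ y, 0 < H y := fun y => lt_max_of_lt_right hε
  have hC0 : 0 < C := by linarith
  have hL : 0 ≤ -Real.log ε := neg_nonneg.2 (Real.log_nonpos hε.le hε1)
  obtain ⟨q, hq1, hq2⟩ : ∃ q, q * m + m ≤ n ∧ n ≤ q * m + 2 * m := by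
    refine ⟨n / m - 1, ?_, ?_⟩
    · have h2 : 1 ≤ n / m := (Nat.one_le_div_iff hm).2 (by omega)
      have := Nat.div_mul_le_self n m
      obtain ⟨t, ht⟩ := Nat.exists_eq_add_of_le h2
      rw [ht] at this ⊢
      simp only [Nat.add_sub_cancel_left]
      linarith
    · have h2 : 1 ≤ n / m := (Nat.one_le_div_iff hm).2 (by omega)
      have := Nat.lt_div_mul_add (a := n) hm
      obtain ⟨t, ht⟩ := Nat.exists_eq_add_of_le h2
      rw [ht] at this ⊢
      simp only [Nat.add_sub_cancel_left]
      linarith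
  have key : ∀ j ∈ Finset.range m, Real.log (φ n x) ≤
      ∑ i ∈ Finset.range q, Real.log (H (T^[i * m + j] x)) + 3 * m * Real.log C := by
    intro j hj
    rw [Finset.mem_range] at hj
    obtain ⟨r, rfl⟩ : ∃ r, n = j + (q * m + r) := ⟨n - j - q * m, by omega⟩
    have hr : j + r ≤ 3 * m := by omega
    set P := ∏ i ∈ Finset.range q, H (T^[i * m] (T^[j] x)) with hP
    have hPpos : 0 < P := Finset.prod_pos fun i _ => hHpos _
    have hPle : φ (q * m) (T^[j] x) ≤ P :=
      submultiplicative_le_prod h0 hsub (fun x => by simpa using hbd 0 x)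
        (fun y => le_max_left _ _) q _
    have h1 : φ (j + (q * m + r)) x ≤ C ^ r * P * C ^ j :=
      (hsub _ _ _).trans (mul_le_mul ((hsub _ _ _).trans
        (mul_le_mul (hbd _ _) hPle (h0 _ _) (by positivity))) (hbd _ _) (h0 _ _) (by positivity))
    have h2 : φ (j + (q * m + r)) x ≤ P * C ^ (3 * m) := by
      refine h1.trans ?_
      have : C ^ r * P * C ^ j = P * C ^ (j + r) := by ring
      rw [this]
      exact mul_le_mul_of_nonneg_left (pow_le_pow_right₀ hC hr) hPpos.le
    refine (Real.log_le_log hx h2).trans (le_of_eq ?_)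
    rw [Real.log_mul hPpos.ne' (by positivity), hP,
      Real.log_prod (fun i _ => (hHpos _).ne'), Real.log_pow]
    simp [Function.iterate_add_apply]
  have hsum := Finset.sum_le_sum key
  rw [Finset.sum_add_distrib, ← sum_range_mul_eq_sum_sum (fun k => Real.log (H (T^[k] x)))]
    at hsum
  simp only [Finset.sum_const, Finset.card_range, nsmul_eq_mul] at hsum
  obtain ⟨r, rfl⟩ : ∃ r, n = q * m + r := ⟨n - q * m, by omega⟩
  have htail : -(2 * m * (-Real.log ε)) ≤
      ∑ k ∈ Finset.range r, Real.log (H (T^[q * m + k] x)) := by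
    have h1 : ∑ k ∈ Finset.range r, Real.log ε ≤
        ∑ k ∈ Finset.range r, Real.log (H (T^[q * m + k] x)) :=
      Finset.sum_le_sum fun k _ => Real.log_le_log hε (le_max_right _ _)
    simp only [Finset.sum_const, Finset.card_range, nsmul_eq_mul] at h1
    have hr : (r : ℝ) ≤ 2 * m := by exact_mod_cast (by omega : r ≤ 2 * m)
    nlinarith [mul_le_mul_of_nonneg_right hr hL]
  rw [Finset.sum_range_add]
  linarith

theorem exists_measurePreserving_mul_log_le_integral {X : Type*} [TopologicalSpace X]
    [CompactSpace X] [T2Space X] [MeasurableSpace X] [BorelSpace X] [HasOuterApproxClosed X]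
    {T : X → X} (hT : Continuous T) {φ : ℕ → X → ℝ} (hφ : ∀ n, Continuous (φ n))
    (h0 : ∀ n x, 0 ≤ φ n x) (hsub : ∀ n m x, φ (n + m) x ≤ φ m (T^[n] x) * φ n x)
    {C : ℝ} (hC : 1 ≤ C) (hbd : ∀ n x, φ n x ≤ C ^ n) {ρ : ℝ} (hρ : 0 < ρ) (x : ℕ → X)
    (hx : Tendsto (fun n : ℕ => φ (n + 1) (x n) ^ (1 / ((n + 1 : ℕ) : ℝ))) atTop (𝓝 ρ)) :
    ∃ μ : Measure X, IsProbabilityMeasure μ ∧ MeasurePreserving T μ μ ∧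
      ∀ m : ℕ, 0 < m → ∀ ε : ℝ, 0 < ε → ε ≤ 1 →
        m * Real.log ρ ≤ ∫ y, Real.log (max (φ m y) ε) ∂μ := by
  obtain ⟨U, μ, hU, hμ, hinv, hlim⟩ := exists_measurePreserving_tendsto_average hT x
  refine ⟨μ, hμ, hinv, fun m hm ε hε hε1 => ?_⟩
  have hcont : Continuous fun y => Real.log (max (φ m y) ε) :=
    ((hφ m).max continuous_const).log fun y => (lt_max_of_lt_right hε).ne'
  have h1 := hlim _ hcont
  set D : ℝ := m * (3 * m * Real.log C) + 2 * m * (-Real.log ε)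
  have h2 : Tendsto (fun n : ℕ => ((n : ℝ) + 1)⁻¹ * D) U (𝓝 0) := by
    have := (tendsto_one_div_add_atTop_nhds_zero_nat (𝕜 := ℝ)).mul_const D
    simpa using this.mono_left hU
  have h3 := h1.add h2
  rw [add_zero] at h3
  have h4 := ((hx.log hρ.ne').const_mul (m : ℝ)).mono_left hU
  refine le_of_tendsto_of_tendsto h4 h3 (hU ?_)
  filter_upwards [hx.eventually (lt_mem_nhds hρ), eventually_ge_atTop (2 * m)] with n hn hn2
  have hpos : 0 < φ (n + 1) (x n) := by
    refine (h0 _ _).lt_of_ne fun h => ?_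
    rw [← h, Real.zero_rpow (by positivity)] at hn
    exact lt_irrefl _ hn
  rw [Real.log_rpow hpos, ← mul_add]
  have key := mul_log_le_sum_add h0 hsub hC hbd hε hε1 hm (by omega : 2 * m ≤ n + 1) hpos
  have hn' : (0 : ℝ) ≤ ((n : ℝ) + 1)⁻¹ := by positivity
  have := mul_le_mul_of_nonneg_left key hn'
  refine le_trans (le_of_eq ?_) this
  push_cast
  ring

/-! ### Extended-real integrals of logarithms -/

theorem integralEReal_le_of_le {X : Type*} [MeasurableSpace X] {μ : Measure X}
    [IsProbabilityMeasure μ] {f : X → EReal} {c : ℝ} (h : ∀ x, f x ≤ c) :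
    integralEReal μ f ≤ c := by
  have hpt : ∀ x, erealToENNReal (f x) + ENNReal.ofReal (-c) ≤
      erealToENNReal (-(f x)) + ENNReal.ofReal c := by
    intro x
    have hx := h x
    induction hfx : f x with
    | bot => simp [erealToENNReal]
    | top => simp [hfx] at hx
    | coe y =>
      rw [hfx, EReal.coe_le_coe_iff] at hx
      simp only [erealToENNReal, EReal.coe_ne_top, if_false, EReal.toReal_coe, ← EReal.coe_neg]
      rcases le_total 0 y with hy | hy <;> rcases le_total 0 c with hc | hc
      · rw [ENNReal.ofReal_of_nonpos (by linarith : -c ≤ 0),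
          ENNReal.ofReal_of_nonpos (by linarith : -y ≤ 0)]
        simpa using ENNReal.ofReal_le_ofReal hx
      · obtain rfl : y = 0 := by linarith
        obtain rfl : c = 0 := by linarith
        simp
      · rw [ENNReal.ofReal_of_nonpos (by linarith : -c ≤ 0), ENNReal.ofReal_of_nonpos hy]
        simp
      · rw [ENNReal.ofReal_of_nonpos hc, ENNReal.ofReal_of_nonpos hy]
        simpa using ENNReal.ofReal_le_ofReal (neg_le_neg hx)
  have hint := lintegral_mono (μ := μ) hpt
  rw [lintegral_add_right _ measurable_const, lintegral_add_right _ measurable_const] at hint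
  simp only [lintegral_const, measure_univ, mul_one] at hint
  unfold integralEReal
  set P := ∫⁻ x, erealToENNReal (f x) ∂μ
  set N := ∫⁻ x, erealToENNReal (-(f x)) ∂μ
  by_cases hN : N = ⊤
  · rw [hN]
    simp
  · have hP : P ≠ ⊤ := by
      intro hP
      rw [hP, top_add, top_le_iff] at hint
      exact ENNReal.add_ne_top.2 ⟨hN, ENNReal.ofReal_ne_top⟩ hint
    rw [← EReal.coe_ennreal_toReal hP, ← EReal.coe_ennreal_toReal hN, ← EReal.coe_sub,
      EReal.coe_le_coe_iff]
    have h2 := ENNReal.toReal_mono (ENNReal.add_ne_top.2 ⟨hN, ENNReal.ofReal_ne_top⟩) hint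
    rw [ENNReal.toReal_add hP ENNReal.ofReal_ne_top, ENNReal.toReal_add hN ENNReal.ofReal_ne_top,
      ENNReal.toReal_ofReal', ENNReal.toReal_ofReal'] at h2
    rcases le_total 0 c with hc | hc
    · rw [max_eq_right (by linarith : -c ≤ 0), max_eq_left hc] at h2
      linarith
    · rw [max_eq_left (by linarith : 0 ≤ -c), max_eq_right hc] at h2
      linarith

theorem integralEReal_bot {X : Type*} [MeasurableSpace X] {μ : Measure X}
    [IsProbabilityMeasure μ] : integralEReal μ (fun _ => ⊥) = ⊥ := by
  simp [integralEReal, erealToENNReal]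

theorem erealToENNReal_elog (y : ℝ) : erealToENNReal (elog y) = ENNReal.ofReal (Real.log y) := by
  by_cases hy : y = 0 <;> simp [erealToENNReal, elog, hy]

theorem erealToENNReal_neg_elog {y : ℝ} (hy : 0 ≤ y) :
    erealToENNReal (-(elog y)) =
      ⨆ k : ℕ, ENNReal.ofReal (-Real.log (max y (Real.exp (-(k : ℝ))))) := by
  rcases hy.eq_or_lt with rfl | hy
  · simp [erealToENNReal, elog, (Real.exp_pos _).le, ENNReal.iSup_natCast]
  · have hL : erealToENNReal (-(elog y)) = ENNReal.ofReal (-Real.log y) := by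
      simp [erealToENNReal, elog, hy.ne', ← EReal.coe_neg]
    rw [hL]
    apply le_antisymm
    · obtain ⟨k, hk⟩ := exists_nat_ge (-Real.log y)
      refine le_iSup_of_le k (le_of_eq ?_)
      rw [max_eq_left]
      rw [← Real.le_log_iff_exp_le hy]
      linarith
    · exact iSup_le fun k => ENNReal.ofReal_le_ofReal
        (neg_le_neg (Real.log_le_log hy (le_max_left _ _)))

theorem ofReal_log_max {y ε : ℝ} (hy : 0 ≤ y) (hε : 0 < ε) (hε1 : ε ≤ 1) :
    ENNReal.ofReal (Real.log (max y ε)) = ENNReal.ofReal (Real.log y) := by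
  rcases le_total ε y with h | h
  · rw [max_eq_left h]
  · rw [max_eq_right h, ENNReal.ofReal_of_nonpos (Real.log_nonpos hε.le hε1),
      ENNReal.ofReal_of_nonpos (Real.log_nonpos hy (h.trans hε1))]

theorem le_integralEReal_elog {X : Type*} [MeasurableSpace X] {μ : Measure X}
    [IsProbabilityMeasure μ] {f : X → ℝ} (hf : Measurable f) (hf0 : ∀ x, 0 ≤ f x) {B : ℝ}
    (hB : ∀ x, f x ≤ B) {c : ℝ}
    (hc : ∀ ε : ℝ, 0 < ε → ε ≤ 1 → c ≤ ∫ x, Real.log (max (f x) ε) ∂μ) :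
    (c : EReal) ≤ integralEReal μ (fun x => elog (f x)) := by
  have hmeas : ∀ ε : ℝ, Measurable fun x => Real.log (max (f x) ε) := fun ε =>
    (hf.max measurable_const).log
  have hintg : ∀ ε : ℝ, 0 < ε → ε ≤ 1 → Integrable (fun x => Real.log (max (f x) ε)) μ := by
    intro ε hε hε1
    refine Integrable.of_bound (hmeas ε).aestronglyMeasurable
      (-Real.log ε + Real.log (max B 1)) (Eventually.of_forall fun x => ?_)
    have h1 : Real.log ε ≤ Real.log (max (f x) ε) := Real.log_le_log hε (le_max_right _ _)
    have h2 : Real.log (max (f x) ε) ≤ Real.log (max B 1) :=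
      Real.log_le_log (lt_max_of_lt_right hε) (max_le_max (hB x) hε1)
    have h3 : 0 ≤ Real.log (max B 1) := Real.log_nonneg (le_max_right _ _)
    have h4 := Real.log_nonpos hε.le hε1
    rw [Real.norm_eq_abs, abs_le]
    constructor <;> linarith
  unfold integralEReal
  simp only [erealToENNReal_elog, fun x => erealToENNReal_neg_elog (hf0 x)]
  have hmeas' : ∀ k : ℕ,
      Measurable fun x => ENNReal.ofReal (-Real.log (max (f x) (Real.exp (-(k : ℝ))))) :=
    fun k => (hmeas _).neg.ennreal_ofReal
  rw [lintegral_iSup hmeas']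
  swap
  · intro k l hkl x
    refine ENNReal.ofReal_le_ofReal (neg_le_neg (Real.log_le_log
      (lt_max_of_lt_right (Real.exp_pos _)) (max_le_max le_rfl (Real.exp_le_exp.2 ?_))))
    exact neg_le_neg (Nat.cast_le.2 hkl)
  set P := ∫⁻ x, ENNReal.ofReal (Real.log (f x)) ∂μ with hPdef
  have hPε : ∀ ε : ℝ, 0 < ε → ε ≤ 1 →
      ∫⁻ x, ENNReal.ofReal (Real.log (max (f x) ε)) ∂μ = P := fun ε hε hε1 =>
    lintegral_congr fun x => ofReal_log_max (hf0 x) hε hε1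
  have hP : P ≠ ⊤ := by
    rw [← hPε 1 one_pos le_rfl]
    exact (hintg 1 one_pos le_rfl).lintegral_lt_top.ne
  have hNk : ∀ k : ℕ, ∫⁻ x, ENNReal.ofReal (-Real.log (max (f x) (Real.exp (-(k : ℝ))))) ∂μ ≤
      ENNReal.ofReal (P.toReal - c) := by
    intro k
    have hε : 0 < Real.exp (-(k : ℝ)) := Real.exp_pos _
    have hε1 : Real.exp (-(k : ℝ)) ≤ 1 := Real.exp_le_one_iff.2 (by simp)
    have h := hc _ hε hε1
    rw [integral_eq_lintegral_pos_part_sub_lintegral_neg_part (hintg _ hε hε1),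
      hPε _ hε hε1] at h
    refine ENNReal.le_ofReal_iff_toReal_le (hintg _ hε hε1).neg.lintegral_lt_top.ne ?_ |>.2 ?_
    · exact ENNReal.toReal_nonneg.trans (le_sub_comm.1 h)
    · exact le_sub_comm.1 h
  have h0 : 0 ≤ P.toReal - c := by
    have h := hc 1 one_pos le_rfl
    rw [integral_eq_lintegral_pos_part_sub_lintegral_neg_part (hintg _ one_pos le_rfl),
      hPε _ one_pos le_rfl] at h
    exact ENNReal.toReal_nonneg.trans (le_sub_comm.1 h)
  have hN := iSup_le hNk
  generalize (⨆ k : ℕ,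
    ∫⁻ x, ENNReal.ofReal (-Real.log (max (f x) (Real.exp (-(k : ℝ))))) ∂μ) = N at hN ⊢
  have hNt : N ≠ ⊤ := ne_top_of_le_ne_top ENNReal.ofReal_ne_top hN
  rw [← EReal.coe_ennreal_toReal hP, ← EReal.coe_ennreal_toReal hNt, ← EReal.coe_sub,
    EReal.coe_le_coe_iff]
  have := ENNReal.toReal_mono ENNReal.ofReal_ne_top hN
  rw [ENNReal.toReal_ofReal h0] at this
  linarith

/-! ### The distance to the finite-rank operators -/

section Operators

variable {E : Type*} [NormedAddCommGroup E] [NormedSpace ℝ E]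

theorem fdist_eq_infDist (L : E →L[ℝ] E) :
    fdist L = Metric.infDist L
      {K : E →L[ℝ] E | FiniteDimensional ℝ (LinearMap.range (K : E →ₗ[ℝ] E))} := by
  rw [Metric.infDist_eq_iInf, fdist, iInf]
  congr 1
  ext c
  simp [dist_eq_norm, eq_comm]

theorem continuous_fdist : Continuous (fdist : (E →L[ℝ] E) → ℝ) := by
  rw [show (fdist : (E →L[ℝ] E) → ℝ) = _ from funext fdist_eq_infDist]
  exact Metric.continuous_infDist_pt _

theorem fdist_nonneg (L : E →L[ℝ] E) : 0 ≤ fdist L := by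
  rw [fdist_eq_infDist]
  exact Metric.infDist_nonneg

theorem fdist_le_norm_sub (L K : E →L[ℝ] E)
    (hK : FiniteDimensional ℝ (LinearMap.range (K : E →ₗ[ℝ] E))) : fdist L ≤ ‖L - K‖ := by
  rw [fdist_eq_infDist, ← dist_eq_norm]
  exact Metric.infDist_le_dist_of_mem hK

theorem finiteDimensional_range_zero :
    FiniteDimensional ℝ (LinearMap.range ((0 : E →L[ℝ] E) : E →ₗ[ℝ] E)) := by
  rw [show ((0 : E →L[ℝ] E) : E →ₗ[ℝ] E) = 0 from rfl, LinearMap.range_zero]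
  infer_instance

theorem fdist_le_norm (L : E →L[ℝ] E) : fdist L ≤ ‖L‖ := by
  simpa using fdist_le_norm_sub L 0 finiteDimensional_range_zero

theorem exists_norm_sub_lt_of_fdist_lt {L : E →L[ℝ] E} {a : ℝ} (h : fdist L < a) :
    ∃ K : E →L[ℝ] E, FiniteDimensional ℝ (LinearMap.range (K : E →ₗ[ℝ] E)) ∧ ‖L - K‖ < a := by
  rw [fdist_eq_infDist, Metric.infDist_lt_iff ⟨0, finiteDimensional_range_zero⟩] at h
  obtain ⟨K, hK, hlt⟩ := h
  exact ⟨K, hK, by rwa [← dist_eq_norm]⟩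

theorem fdist_mul_le (L M : E →L[ℝ] E) : fdist (L * M) ≤ fdist L * fdist M := by
  refine le_mul_of_forall_lt₀ fun a ha b hb => ?_
  obtain ⟨K, hK, hKa⟩ := exists_norm_sub_lt_of_fdist_lt ha
  obtain ⟨K', hK', hKb⟩ := exists_norm_sub_lt_of_fdist_lt hb
  have hfin : FiniteDimensional ℝ
      (LinearMap.range ((K * M + (L - K) * K' : E →L[ℝ] E) : E →ₗ[ℝ] E)) := by
    refine Submodule.finiteDimensional_of_le (S₂ := LinearMap.range (K : E →ₗ[ℝ] E) ⊔
      (LinearMap.range (K' : E →ₗ[ℝ] E)).map ((L - K : E →L[ℝ] E) : E →ₗ[ℝ] E)) ?_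
    rintro _ ⟨v, rfl⟩
    exact Submodule.add_mem_sup ⟨M v, rfl⟩ ⟨K' v, ⟨v, rfl⟩, rfl⟩
  have heq : L * M - (K * M + (L - K) * K') = (L - K) * (M - K') := by noncomm_ring
  calc fdist (L * M) ≤ ‖L * M - (K * M + (L - K) * K')‖ := fdist_le_norm_sub _ _ hfin
    _ = ‖(L - K) * (M - K')‖ := by rw [heq]
    _ ≤ ‖L - K‖ * ‖M - K'‖ := norm_mul_le _ _
    _ ≤ a * b := mul_le_mul hKa.le hKb.le (norm_nonneg _) ((norm_nonneg _).trans hKa.le)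

/-! ### The shift cocycle -/

theorem continuous_shiftT (A : Set (E →L[ℝ] E)) : Continuous (shiftT A) :=
  continuous_pi fun i => continuous_apply (i + 1)

theorem iterate_shiftT_apply (A : Set (E →L[ℝ] E)) (n : ℕ) (x : ℤ → ↥A) (i : ℤ) :
    (shiftT A)^[n] x i = x (i + n) := by
  induction n generalizing x with
  | zero => simp
  | succ n ih =>
    rw [Function.iterate_succ_apply, ih, shiftT]
    congr 1
    push_cast
    ring

theorem shiftCocycle_add (A : Set (E →L[ℝ] E)) (x : ℤ → ↥A) (n m : ℕ) :
    shiftCocycle A x (n + m) =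
      shiftCocycle A ((shiftT A)^[n] x) m * shiftCocycle A x n := by
  rw [add_comm n m, shiftCocycle, List.ofFn_add, List.prod_append, shiftCocycle, shiftCocycle]
  simp only [iterate_shiftT_apply]
  congr 4 <;> funext i <;> congr 2
  · rw [Fin.val_castLE]
    push_cast
    ring
  · simp

theorem continuous_shiftCocycle (A : Set (E →L[ℝ] E)) (n : ℕ) :
    Continuous fun x : ℤ → ↥A => shiftCocycle A x n := by
  simp only [shiftCocycle, List.ofFn_eq_map]
  exact continuous_list_prod _ fun i _ =>
    continuous_subtype_val.comp (continuous_apply _)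

theorem shiftCocycle_mem_prods (A : Set (E →L[ℝ] E)) (x : ℤ → ↥A) (n : ℕ) :
    shiftCocycle A x n ∈ prods A n :=
  ⟨_, fun _ => Subtype.coe_prop _, rfl⟩

theorem exists_shiftCocycle_eq {A : Set (E →L[ℝ] E)} (hne : A.Nonempty) {n : ℕ}
    {P : E →L[ℝ] E} (hP : P ∈ prods A n) : ∃ x : ℤ → ↥A, shiftCocycle A x n = P := by
  obtain ⟨f, hf, rfl⟩ := hP
  obtain ⟨a, ha⟩ := hne
  refine ⟨fun j => if h : ((n : ℤ) - j).toNat < n then ⟨f ⟨_, h⟩, hf _⟩ else ⟨a, ha⟩, ?_⟩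
  rw [shiftCocycle]
  congr 2
  funext i
  simp

theorem fdist_le_pow_of_mem_prods {A : Set (E →L[ℝ] E)} {C : ℝ} (hC : 1 ≤ C)
    (hA : ∀ L ∈ A, ‖L‖ ≤ C) {n : ℕ} {P : E →L[ℝ] E} (hP : P ∈ prods A n) :
    fdist P ≤ C ^ n := by
  obtain ⟨f, hf, rfl⟩ := hP
  refine (fdist_le_norm _).trans ?_
  induction n with
  | zero => exact ContinuousLinearMap.norm_id_le
  | succ n ih =>
    rw [List.ofFn_succ, List.prod_cons, pow_succ']
    exact (norm_mul_le _ _).trans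
      (mul_le_mul (hA _ (hf _)) (ih _ fun i => hf _) (norm_nonneg _) (by linarith))

end Operators

/-! ### The variational principle -/

theorem elog_le_elog {a b : ℝ} (ha : 0 ≤ a) (h : a ≤ b) : elog a ≤ elog b := by
  rcases ha.eq_or_lt with rfl | ha
  · simp [elog]
  · simpa [elog, ha.ne', (ha.trans_le h).ne'] using Real.log_le_log ha h

theorem le_elog_of_tendsto {s : ℕ → ℝ} (hs : ∀ n, 0 ≤ s n) {ρ : ℝ}
    (h : Tendsto s atTop (𝓝 ρ)) {c : EReal} (hc : ∀ n, c ≤ elog (s n)) : c ≤ elog ρ := by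
  have hρ : 0 ≤ ρ := ge_of_tendsto' h hs
  rcases hρ.eq_or_lt with rfl | hρ
  · rw [elog, if_pos rfl, le_bot_iff, EReal.eq_bot_iff_forall_lt]
    intro y
    obtain ⟨n, hn⟩ := (h.eventually (gt_mem_nhds (Real.exp_pos y))).exists
    refine (hc n).trans_lt ?_
    rcases (hs n).eq_or_lt with h0 | h0
    · simp [elog, ← h0]
    · rw [elog, if_neg h0.ne', EReal.coe_lt_coe_iff]
      exact (Real.log_lt_iff_lt_exp h0).2 hn
  · rw [elog, if_neg hρ.ne']
    refine ge_of_tendsto (EReal.tendsto_coe.2 (h.log hρ.ne')) ?_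
    filter_upwards [h.eventually (lt_mem_nhds hρ)] with n hn
    simpa [elog, hn.ne'] using hc n

theorem inv_mul_integralEReal_elog_le {X : Type*} [MeasurableSpace X] {μ : Measure X}
    [IsProbabilityMeasure μ] {f : X → ℝ} (hf0 : ∀ x, 0 ≤ f x) {s : ℝ} (hs : 0 ≤ s) (n : ℕ)
    (hfs : ∀ x, f x ^ (1 / ((n + 1 : ℕ) : ℝ)) ≤ s) :
    ((((n : ℝ) + 1)⁻¹ : ℝ) : EReal) * integralEReal μ (fun x => elog (f x)) ≤ elog s := by
  have hn : (0 : ℝ) < (n : ℝ) + 1 := by positivity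
  have hfs' : ∀ x, f x ≤ s ^ (n + 1) := fun x => by
    have := pow_le_pow_left₀ (Real.rpow_nonneg (hf0 x) _) (hfs x) (n + 1)
    rwa [one_div, Real.rpow_inv_natCast_pow (hf0 x) (by simp)] at this
  rcases hs.eq_or_lt with rfl | hs
  · have : (fun x => elog (f x)) = fun _ => ⊥ := by
      funext x
      have : f x = 0 := le_antisymm (by simpa using hfs' x) (hf0 x)
      simp [elog, this]
    rw [this, integralEReal_bot, EReal.mul_bot_of_pos (by exact_mod_cast inv_pos.2 hn)]
    exact bot_le
  · have h1 : integralEReal μ (fun x => elog (f x)) ≤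
        ((((n : ℝ) + 1) * Real.log s : ℝ) : EReal) := by
      refine integralEReal_le_of_le fun x => (elog_le_elog (hf0 x) (hfs' x)).trans ?_
      simp [elog, hs.ne']
    calc _ ≤ ((((n : ℝ) + 1)⁻¹ : ℝ) : EReal) * ((((n : ℝ) + 1) * Real.log s : ℝ) : EReal) :=
          mul_le_mul_of_nonneg_left h1 (by exact_mod_cast (inv_pos.2 hn).le)
      _ = elog s := by
        rw [← EReal.coe_mul, inv_mul_cancel_left₀ hn.ne', elog, if_neg hs.ne']

/-- **Variational characterization of `ρ_f`:** for a compact nonempty set `𝖠 ⊆ B(𝔛)`,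
`log ρ_f(𝖠) = sup_{μ ∈ M_T} inf_{n ≥ 1} (1/n) ∫ log ‖𝒜(x,n)‖_f dμ(x)`, where `M_T` is
the set of shift-invariant Borel probability measures on `𝖠^ℤ`.  The limit defining
`ρ_f(𝖠)` (which exists by submultiplicativity) is supplied as hypothesis `hf`. -/
theorem f_radius_variational_principle [MeasurableSpace (𝕏 →L[ℝ] 𝕏)] [BorelSpace (𝕏 →L[ℝ] 𝕏)]
    (A : Set (𝕏 →L[ℝ] 𝕏)) (hA : IsCompact A) (hne : A.Nonempty) (ρf : ℝ)
    (hf : Tendsto (fun n : ℕ => sSup ((fun P => fdist P ^ (1 / (n : ℝ))) '' prods A n))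
      atTop (nhds ρf)) :
    elog ρf =
      ⨆ μ : {μ : Measure (ℤ → ↥A) //
          IsProbabilityMeasure μ ∧ MeasurePreserving (shiftT A) μ μ},
        ⨅ n : ℕ, ((((n : ℝ) + 1)⁻¹ : ℝ) : EReal) *
          integralEReal μ.1 (fun x => elog (fdist (shiftCocycle A x (n + 1)))) := by
  have : CompactSpace ↥A := isCompact_iff_compactSpace.1 hA
  obtain ⟨C, hC, hAC⟩ : ∃ C : ℝ, 1 ≤ C ∧ ∀ L ∈ A, ‖L‖ ≤ C := by
    obtain ⟨C, hC⟩ := hA.isBounded.exists_norm_le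
    exact ⟨max C 1, le_max_right _ _, fun L hL => (hC L hL).trans (le_max_left _ _)⟩
  set s : ℕ → ℝ := fun n => sSup ((fun P => fdist P ^ (1 / (n : ℝ))) '' prods A n) with hsdef
  have hbdd : ∀ n : ℕ,
      BddAbove ((fun P : 𝕏 →L[ℝ] 𝕏 => fdist P ^ (1 / (n : ℝ))) '' prods A n) := by
    intro n
    refine ⟨(C ^ n) ^ (1 / (n : ℝ)), ?_⟩
    rintro _ ⟨P, hP, rfl⟩
    exact Real.rpow_le_rpow (fdist_nonneg _) (fdist_le_pow_of_mem_prods hC hAC hP) (by positivity)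
  have hs0 : ∀ n, 0 ≤ s n := by
    intro n
    refine Real.sSup_nonneg ?_
    rintro _ ⟨P, -, rfl⟩
    exact Real.rpow_nonneg (fdist_nonneg _) _
  have hs1 : Tendsto (fun n => s (n + 1)) atTop (𝓝 ρf) := (tendsto_add_atTop_iff_nat 1).2 hf
  have hle : ∀ (x : ℤ → ↥A) (n : ℕ), fdist (shiftCocycle A x n) ^ (1 / (n : ℝ)) ≤ s n :=
    fun x n => le_csSup (hbdd n) ⟨_, shiftCocycle_mem_prods A x n, rfl⟩
  apply le_antisymm
  · rcases (ge_of_tendsto' hf hs0).eq_or_lt with rfl | hρ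
    · simp [elog]
    have hex : ∀ n : ℕ, ∃ x : ℤ → ↥A, s (n + 1) - 1 / ((n : ℝ) + 1) <
        fdist (shiftCocycle A x (n + 1)) ^ (1 / ((n + 1 : ℕ) : ℝ)) := by
      intro n
      obtain ⟨a, ha⟩ := hne
      have hnon : ((fun P : 𝕏 →L[ℝ] 𝕏 => fdist P ^ (1 / ((n + 1 : ℕ) : ℝ))) ''
          prods A (n + 1)).Nonempty := ⟨_, _, ⟨fun _ => a, fun _ => ha, rfl⟩, rfl⟩
      have hlt : s (n + 1) - 1 / ((n : ℝ) + 1) < s (n + 1) :=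
        sub_lt_self _ (by positivity)
      obtain ⟨_, ⟨P, hP, rfl⟩, hPlt⟩ := exists_lt_of_lt_csSup hnon hlt
      obtain ⟨x, rfl⟩ := exists_shiftCocycle_eq ⟨a, ha⟩ hP
      exact ⟨x, hPlt⟩
    choose x hx using hex
    have hlim : Tendsto (fun n : ℕ => fdist (shiftCocycle A (x n) (n + 1)) ^
        (1 / ((n + 1 : ℕ) : ℝ))) atTop (𝓝 ρf) := by
      refine tendsto_of_tendsto_of_tendsto_of_le_of_le ?_ hs1 (fun n => (hx n).le)
        (fun n => hle (x n) (n + 1))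
      simpa using hs1.sub (tendsto_one_div_add_atTop_nhds_zero_nat (𝕜 := ℝ))
    have hcont : ∀ n, Continuous fun x : ℤ → ↥A => fdist (shiftCocycle A x n) :=
      fun n => continuous_fdist.comp (continuous_shiftCocycle A n)
    obtain ⟨μ, hμ, hinv, hint⟩ := exists_measurePreserving_mul_log_le_integral
      (continuous_shiftT A) (φ := fun n x => fdist (shiftCocycle A x n)) hcont
      (fun _ _ => fdist_nonneg _)
      (fun n m x => by rw [shiftCocycle_add]; exact fdist_mul_le _ _) hC
      (fun n x => fdist_le_pow_of_mem_prods hC hAC (shiftCocycle_mem_prods A x n)) hρ x hlim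
    refine le_iSup_of_le ⟨μ, hμ, hinv⟩ (le_iInf fun n => ?_)
    have hn : (0 : ℝ) < (n : ℝ) + 1 := by positivity
    have key : ((((n + 1 : ℕ) : ℝ) * Real.log ρf : ℝ) : EReal) ≤
        integralEReal μ (fun x => elog (fdist (shiftCocycle A x (n + 1)))) :=
      le_integralEReal_elog (hcont (n + 1)).measurable (fun _ => fdist_nonneg _)
        (fun x => fdist_le_pow_of_mem_prods hC hAC (shiftCocycle_mem_prods A x (n + 1)))
        (hint (n + 1) n.succ_pos)
    refine le_trans (le_of_eq ?_) (mul_le_mul_of_nonneg_left key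
      (by exact_mod_cast (inv_pos.2 hn).le))
    rw [← EReal.coe_mul, Nat.cast_add, Nat.cast_one, inv_mul_cancel_left₀ hn.ne', elog,
      if_neg hρ.ne']
  · refine iSup_le fun ⟨μ, hμ, _⟩ => le_elog_of_tendsto (fun n => hs0 (n + 1)) hs1 fun n => ?_
    exact (iInf_le _ n).trans (inv_mul_integralEReal_elog_le (fun _ => fdist_nonneg _)
      (hs0 (n + 1)) n fun x => hle x (n + 1))
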